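/- arXiv:2202.06320 — 5 statements merged into one kernel-verified Lean document; each statement's English description precedes it below -/
import Mathlib

section
/- Let β : [0,∞) → ℝ be continuous with β(t) > 0 for all t ≥ 0 and β(0) = 1. Let ψ : ℝ → ℝ be continuous with ψ(x)² < 1 for all x ∈ ℝ. Let x : [0,∞) → ℝ be continuous, and suppose there exists M ≥ 0 such that |β(t)·ψ(x(t))| ≤ M·|β(t)² − ψ(x(t))²| for all t ≥ 0 (i.e. the transformed signal z(t) = β(t)ψ(x(t))/(β(t)² − ψ(x(t))²) is well defined and bounded on [0,∞)). Then ψ(x(t))² < β(t)² for all t ≥ 0. -/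
/-- Lemma 1: boundedness of the transformed signal `z = β ψ(x) / (β² − ψ(x)²)`
forces the trajectory to stay strictly inside the performance funnel. -/
theorem stmt_0 (β ψ x : ℝ → ℝ)
    (hβc : ContinuousOn β (Set.Ici 0))
    (hβpos : ∀ t ≥ (0 : ℝ), 0 < β t)
    (hβ0 : β 0 = 1)
    (hψc : Continuous ψ)
    (hψlt : ∀ y : ℝ, (ψ y) ^ 2 < 1)
    (hxc : ContinuousOn x (Set.Ici 0))
    (M : ℝ) (hM : 0 ≤ M)
    (hbound : ∀ t ≥ (0 : ℝ),
      |β t * ψ (x t)| ≤ M * |(β t) ^ 2 - (ψ (x t)) ^ 2|) :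
    ∀ t ≥ (0 : ℝ), (ψ (x t)) ^ 2 < (β t) ^ 2 := by
  intro t ht
  by_contra! hle
  have hcont : ContinuousOn (fun s => (β s) ^ 2 - (ψ (x s)) ^ 2) (Set.Icc 0 t) :=
    ((hβc.pow 2).sub ((hψc.comp_continuousOn hxc).pow 2)).mono Set.Icc_subset_Ici_self
  have hzero : (0 : ℝ) ∈ Set.Icc ((β t) ^ 2 - (ψ (x t)) ^ 2) ((β 0) ^ 2 - (ψ (x 0)) ^ 2) := by
    have := hψlt (x 0)
    rw [hβ0]
    constructor <;> linarith
  obtain ⟨s, hs, hfs⟩ := intermediate_value_Icc' ht hcont hzero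
  have hfs' : (β s) ^ 2 - (ψ (x s)) ^ 2 = 0 := hfs
  have hβs := hβpos s hs.1
  have hprod : β s * ψ (x s) = 0 := by
    have hnonpos := hbound s hs.1
    rw [hfs', abs_zero, mul_zero] at hnonpos
    exact abs_nonpos_iff.mp hnonpos
  have hψs : ψ (x s) = 0 := (mul_eq_zero.mp hprod).resolve_left hβs.ne'
  rw [hψs] at hfs'
  nlinarith
end

section
/- Consider the scalar time-varying system ẋ = b(t)u + θ(t)x under the prescribed-performance adaptive controller built from ψ = tanh. Assume: β : ℝ → ℝ is differentiable with β(0) = 1, β(t) ≥ β_min for some constant β_min > 0 and all t ≥ 0, and both β and β′ are bounded on [0,∞); θ : [0,∞) → ℝ satisfies |θ(t) − ℓ_θ| ≤ δ for all t ≥ 0, for some constant ℓ_θ ∈ ℝ and constant δ ≥ 0; b : [0,∞) → ℝ satisfies b(t) ≥ ℓ_b for all t ≥ 0, for some constant ℓ_b > 0; and the gains satisfy k > 0, γ_θ > 0, γ_ρ > 0. For t ≥ 0 define (writing ψ = tanh(x(t)), d = β(t)² − ψ²): z = β(t)ψ/d, Π = β(t)(1−ψ²)(β(t)²+ψ²)/d²,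 W = β(t) if x(t) = 0 and W = x(t)·d/(β(t)ψ) otherwise, Φ = −β′(t)/β(t) if x(t) = 0 and Φ = −β′(t)ψ/(β(t)(1−ψ²)x(t)) otherwise, κ = k/Π + (δ+1)/2 + (W²/2)(θ̂(t)+Φ)², ū = −κ·z, u = ρ̂(t)·ū. Suppose x, θ̂, ρ̂ : [0,∞) → ℝ are differentiable and satisfy for all t ≥ 0: x′(t) = b(t)u(t) + θ(t)x(t), θ̂′(t) = γ_θ·z·Π·x(t), ρ̂′(t) = −γ_ρ·z·Π·ū, with initial condition ρ̂(0) > 0. Then: (i) tanh(x(t))² < β(t)² for all t ≥ 0; (ii) x(t) → 0 as t → ∞; (iii) θ̂(t) and ρ̂(t) converge to finite limits as t → ∞; (iv) x, u, θ̂′ and ρ̂′ are bounded on [0,∞). -/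
open Set Filter Topology

theorem Real.one_sub_tanh_sq (x : ℝ) : 1 - Real.tanh x ^ 2 = (Real.cosh x ^ 2)⁻¹ := by
  have hc := (Real.cosh_pos x).ne'
  rw [Real.tanh_eq_sinh_div_cosh]
  field_simp
  linarith [Real.cosh_sq x]

theorem Real.hasDerivAt_tanh' (x : ℝ) : HasDerivAt Real.tanh (1 - Real.tanh x ^ 2) x := by
  have hc := (Real.cosh_pos x).ne'
  have h := (Real.hasDerivAt_sinh x).div (Real.hasDerivAt_cosh x) hc
  have he : Real.tanh = Real.sinh / Real.cosh := funext Real.tanh_eq_sinh_div_cosh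
  rw [he]
  refine h.congr_deriv ?_
  rw [← he, Real.tanh_eq_sinh_div_cosh]
  field_simp

theorem Real.abs_tanh (x : ℝ) : |Real.tanh x| = Real.tanh |x| := by
  rw [Real.tanh_eq_sinh_div_cosh, Real.tanh_eq_sinh_div_cosh, abs_div, Real.abs_sinh,
    abs_of_pos (Real.cosh_pos x), Real.cosh_abs]

theorem Real.abs_tanh_le (x : ℝ) : |Real.tanh x| ≤ |x| := by
  have hm : AntitoneOn (fun y => Real.tanh y - y) (Ici 0) := by
    refine antitoneOn_of_hasDerivWithinAt_nonpos (f' := fun y => 1 - Real.tanh y ^ 2 - 1)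
      (convex_Ici 0) ?_ ?_ ?_
    · exact fun y _ => ((Real.hasDerivAt_tanh' y).sub (hasDerivAt_id y)).continuousAt.continuousWithinAt
    · exact fun y _ => ((Real.hasDerivAt_tanh' y).sub (hasDerivAt_id y)).hasDerivWithinAt
    · intro y _
      nlinarith [sq_nonneg (Real.tanh y)]
  have h := hm (mem_Ici.2 le_rfl) (mem_Ici.2 (abs_nonneg x)) (abs_nonneg x)
  simp only [Real.tanh_zero, sub_zero] at h
  rw [Real.abs_tanh]
  linarith

theorem Real.abs_mul_one_sub_tanh_sq_le (x : ℝ) :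
    |x| * (1 - Real.tanh x ^ 2) ≤ |Real.tanh x| := by
  have h1 : |x| ≤ Real.sinh |x| := Real.self_le_sinh_iff.2 (abs_nonneg x)
  have h2 := Real.one_le_cosh x
  have h3 := Real.cosh_pos x
  rw [Real.one_sub_tanh_sq, Real.tanh_eq_sinh_div_cosh, abs_div, Real.abs_sinh, abs_of_pos h3,
    ← div_eq_mul_inv, div_le_div_iff₀ (by positivity) h3]
  have h4 : 0 ≤ |x| := abs_nonneg x
  have h5 : Real.cosh x ≤ Real.cosh x ^ 2 := by nlinarith
  exact mul_le_mul h1 h5 h3.le (h4.trans h1)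

theorem Real.mul_tanh_pos {x : ℝ} (hx : x ≠ 0) : 0 < x * Real.tanh x := by
  have h : 0 < |x| * |Real.tanh x| := by
    refine lt_of_lt_of_le ?_ (mul_le_mul_of_nonneg_left (Real.abs_mul_one_sub_tanh_sq_le x)
      (abs_nonneg x))
    have h1 := abs_pos.2 hx
    have h2 := Real.tanh_sq_lt_one x
    have : 0 < 1 - Real.tanh x ^ 2 := by linarith
    positivity
  rw [← abs_mul] at h
  rcases abs_cases (x * Real.tanh x) with h' | h'
  · linarith [h'.1]
  · exfalso
    have hs : 0 ≤ x * Real.tanh x := by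
      rw [Real.tanh_eq_sinh_div_cosh, ← mul_div_assoc]
      refine div_nonneg ?_ (Real.cosh_pos x).le
      rcases le_total 0 x with h0 | h0
      · exact mul_nonneg h0 (Real.sinh_nonneg_iff.2 h0)
      · exact mul_nonneg_of_nonpos_of_nonpos h0 (Real.sinh_nonpos_iff.2 h0)
    linarith [h'.2]

theorem funnel_gain_pos {B x P : ℝ} (hB : 0 < B)
    (hd : Real.tanh x ^ 2 < B ^ 2)
    (hP : P = B * (1 - Real.tanh x ^ 2) * (B ^ 2 + Real.tanh x ^ 2) /
      (B ^ 2 - Real.tanh x ^ 2) ^ 2) : 0 < P := by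
  have h1 : 0 < 1 - Real.tanh x ^ 2 := sub_pos.2 (Real.tanh_sq_lt_one x)
  have h2 : 0 < B ^ 2 - Real.tanh x ^ 2 := sub_pos.2 hd
  rw [hP]
  positivity

theorem funnel_ratio_pos {B x W : ℝ} (hB : 0 < B)
    (hd : Real.tanh x ^ 2 < B ^ 2)
    (hW : W = if x = 0 then B
      else x * (B ^ 2 - Real.tanh x ^ 2) / (B * Real.tanh x)) : 0 < W := by
  have h2 : 0 < B ^ 2 - Real.tanh x ^ 2 := sub_pos.2 hd
  rw [hW]
  split_ifs with h
  · exact hB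
  · have h3 := Real.mul_tanh_pos h
    have h4 : Real.tanh x ≠ 0 := right_ne_zero_of_mul h3.ne'
    have : x * (B ^ 2 - Real.tanh x ^ 2) / (B * Real.tanh x) =
        (x * Real.tanh x) * (B ^ 2 - Real.tanh x ^ 2) / (B * Real.tanh x ^ 2) := by
      field_simp
    rw [this]
    positivity

theorem funnel_ratio_mul {B x z W : ℝ} (hB : 0 < B)
    (hd : Real.tanh x ^ 2 < B ^ 2)
    (hz : z = B * Real.tanh x / (B ^ 2 - Real.tanh x ^ 2))
    (hW : W = if x = 0 then B
      else x * (B ^ 2 - Real.tanh x ^ 2) / (B * Real.tanh x)) : W * z = x := by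
  have h2 : 0 < B ^ 2 - Real.tanh x ^ 2 := sub_pos.2 hd
  rw [hW, hz]
  split_ifs with h
  · simp [h]
  · have h4 : Real.tanh x ≠ 0 := right_ne_zero_of_mul (Real.mul_tanh_pos h).ne'
    field_simp

theorem funnel_drift_eq {B D x P F : ℝ} (hB : 0 < B)
    (hd : Real.tanh x ^ 2 < B ^ 2)
    (hP : P = B * (1 - Real.tanh x ^ 2) * (B ^ 2 + Real.tanh x ^ 2) /
      (B ^ 2 - Real.tanh x ^ 2) ^ 2)
    (hF : F = if x = 0 then -D / B
      else -D * Real.tanh x / (B * (1 - Real.tanh x ^ 2) * x)) : P * F * x =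
    -(Real.tanh x * D * (B ^ 2 + Real.tanh x ^ 2) / (B ^ 2 - Real.tanh x ^ 2) ^ 2) := by
  have h1 : 0 < 1 - Real.tanh x ^ 2 := sub_pos.2 (Real.tanh_sq_lt_one x)
  have h2 : 0 < B ^ 2 - Real.tanh x ^ 2 := sub_pos.2 hd
  rw [hP, hF]
  split_ifs with h
  · simp [h]
  · field_simp

theorem funnel_ratio_le {B x W : ℝ} (hB : 0 < B)
    (hd : Real.tanh x ^ 2 < B ^ 2)
    (hW : W = if x = 0 then B
      else x * (B ^ 2 - Real.tanh x ^ 2) / (B * Real.tanh x)) :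
    W ≤ (B ^ 2 - Real.tanh x ^ 2) * B⁻¹ * (1 - Real.tanh x ^ 2)⁻¹ := by
  have h1 : 0 < 1 - Real.tanh x ^ 2 := sub_pos.2 (Real.tanh_sq_lt_one x)
  have h2 : 0 < B ^ 2 - Real.tanh x ^ 2 := sub_pos.2 hd
  have hpos := funnel_ratio_pos hB hd hW
  rw [← abs_of_pos hpos, hW]
  split_ifs with h
  · rw [abs_of_pos hB]
    simp only [h, Real.tanh_zero]
    field_simp
    norm_num
  · have h4 : Real.tanh x ≠ 0 := right_ne_zero_of_mul (Real.mul_tanh_pos h).ne'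
    have h5 := abs_pos.2 h4
    rw [abs_div, abs_mul, abs_mul, abs_of_pos h2, abs_of_pos hB]
    have h6 := Real.abs_mul_one_sub_tanh_sq_le x
    rw [div_le_iff₀ (by positivity)]
    have : (B ^ 2 - Real.tanh x ^ 2) * B⁻¹ * (1 - Real.tanh x ^ 2)⁻¹ * (B * |Real.tanh x|) =
      |Real.tanh x| / (1 - Real.tanh x ^ 2) * (B ^ 2 - Real.tanh x ^ 2) := by
      field_simp
    rw [this]
    exact mul_le_mul_of_nonneg_right ((le_div_iff₀ h1).2 h6) h2.le

theorem funnel_gain_mul_ratio_le {B x P W : ℝ} (hB : 0 < B)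
    (hd : Real.tanh x ^ 2 < B ^ 2)
    (hP : P = B * (1 - Real.tanh x ^ 2) * (B ^ 2 + Real.tanh x ^ 2) /
      (B ^ 2 - Real.tanh x ^ 2) ^ 2)
    (hW : W = if x = 0 then B
      else x * (B ^ 2 - Real.tanh x ^ 2) / (B * Real.tanh x)) :
    P * W ≤ (B ^ 2 + Real.tanh x ^ 2) * (B ^ 2 - Real.tanh x ^ 2)⁻¹ := by
  have h1 : 0 < 1 - Real.tanh x ^ 2 := sub_pos.2 (Real.tanh_sq_lt_one x)
  have h2 : 0 < B ^ 2 - Real.tanh x ^ 2 := sub_pos.2 hd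
  refine (mul_le_mul_of_nonneg_left (funnel_ratio_le hB hd hW)
    (funnel_gain_pos hB hd hP).le).trans_eq ?_
  rw [hP]
  field_simp

theorem funnel_feedforward_abs_le {B D x F : ℝ} (hB : 0 < B)
    (hF : F = if x = 0 then -D / B
      else -D * Real.tanh x / (B * (1 - Real.tanh x ^ 2) * x)) : |F| ≤ |D| * B⁻¹ * (1 - Real.tanh x ^ 2)⁻¹ := by
  have h1 : 0 < 1 - Real.tanh x ^ 2 := sub_pos.2 (Real.tanh_sq_lt_one x)
  rw [hF]
  split_ifs with h
  · simp [h, abs_of_pos hB, div_eq_mul_inv]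
  · have h4 := abs_pos.2 h
    rw [abs_div, abs_mul, abs_mul, abs_mul, abs_neg, abs_of_pos hB, abs_of_pos h1,
      div_le_iff₀ (by positivity)]
    have : |D| * B⁻¹ * (1 - Real.tanh x ^ 2)⁻¹ * (B * (1 - Real.tanh x ^ 2) * |x|) = |D| * |x| := by
      field_simp
    rw [this]
    exact mul_le_mul_of_nonneg_left (Real.abs_tanh_le x) (abs_nonneg D)

theorem hasDerivAt_funnel_transform {β x : ℝ → ℝ} {t β' x' : ℝ} (hβ : HasDerivAt β β' t)
    (hx : HasDerivAt x x' t) (hd : β t ^ 2 - Real.tanh (x t) ^ 2 ≠ 0) :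
    HasDerivAt (fun s => β s * Real.tanh (x s) / (β s ^ 2 - Real.tanh (x s) ^ 2))
      (β t * (1 - Real.tanh (x t) ^ 2) * (β t ^ 2 + Real.tanh (x t) ^ 2) /
          (β t ^ 2 - Real.tanh (x t) ^ 2) ^ 2 * x' -
        Real.tanh (x t) * β' * (β t ^ 2 + Real.tanh (x t) ^ 2) /
          (β t ^ 2 - Real.tanh (x t) ^ 2) ^ 2) t := by
  have hψ := (Real.hasDerivAt_tanh' (x t)).comp t hx
  refine ((hβ.mul hψ).div ((hβ.pow 2).sub (hψ.pow 2)) hd).congr_deriv ?_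
  simp only [Pi.mul_apply, Pi.sub_apply, Pi.pow_apply, Function.comp]
  field_simp
  ring

theorem AntitoneOn.exists_tendsto_of_bddBelow {f : ℝ → ℝ} {a m : ℝ} (hf : AntitoneOn f (Ici a))
    (hm : ∀ t ≥ a, m ≤ f t) : ∃ l, Tendsto f atTop (𝓝 l) := by
  have h : Antitone fun t => f (max a t) := fun s t hst =>
    hf (mem_Ici.2 (le_max_left _ _)) (mem_Ici.2 (le_max_left _ _)) (max_le_max_left a hst)
  refine ⟨_, (tendsto_atTop_ciInf h ⟨m, ?_⟩).congr' ?_⟩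
  · rintro _ ⟨t, rfl⟩
    exact hm _ (le_max_left _ _)
  · filter_upwards [eventually_ge_atTop a] with t ht
    rw [max_eq_right ht]

theorem MonotoneOn.exists_tendsto_of_bddAbove {f : ℝ → ℝ} {a M : ℝ} (hf : MonotoneOn f (Ici a))
    (hM : ∀ t ≥ a, f t ≤ M) : ∃ l, Tendsto f atTop (𝓝 l) := by
  obtain ⟨l, hl⟩ := AntitoneOn.exists_tendsto_of_bddBelow (f := fun t => -f t) (m := -M) hf.neg
    fun t ht => neg_le_neg (hM t ht)
  exact ⟨-l, by simpa using hl.neg⟩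

theorem antitoneOn_of_hasDerivAt_nonpos {S : Set ℝ} (hS : Convex ℝ S) {f f' : ℝ → ℝ}
    (hf : ∀ t ∈ S, HasDerivAt f (f' t) t) (hf' : ∀ t ∈ S, f' t ≤ 0) : AntitoneOn f S :=
  antitoneOn_of_hasDerivWithinAt_nonpos hS (fun t ht => (hf t ht).continuousAt.continuousWithinAt)
    (fun t ht => (hf t (interior_subset ht)).hasDerivWithinAt)
    fun t ht => hf' t (interior_subset ht)

/-- A Barbalat-type lemma in which the integrand only needs a one-sided growth bound. -/
theorem tendsto_zero_of_lyapunov {f f' V V' : ℝ → ℝ} {c C : ℝ} (hc : 0 < c)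
    (hf : ∀ t ∈ Ici (0 : ℝ), HasDerivAt f (f' t) t) (hV : ∀ t ∈ Ici (0 : ℝ), HasDerivAt V (V' t) t)
    (hf0 : ∀ t ∈ Ici (0 : ℝ), 0 ≤ f t) (hV0 : ∀ t ∈ Ici (0 : ℝ), 0 ≤ V t) (hC : 0 ≤ C)
    (hf' : ∀ t ∈ Ici (0 : ℝ), f' t ≤ C * f t) (hV' : ∀ t ∈ Ici (0 : ℝ), V' t ≤ -(c * f t)) :
    Tendsto f atTop (𝓝 0) := by
  have hVa : AntitoneOn V (Ici 0) := antitoneOn_of_hasDerivAt_nonpos (convex_Ici 0) hV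
    fun t ht => (hV' t ht).trans (by have := mul_nonneg hc.le (hf0 t ht); linarith)
  have hGa : AntitoneOn (fun t => f t + C / c * V t) (Ici 0) := by
    refine antitoneOn_of_hasDerivAt_nonpos (convex_Ici 0)
      (fun t ht => (hf t ht).add ((hV t ht).const_mul (C / c))) fun t ht => ?_
    have h1 := mul_le_mul_of_nonneg_left (hV' t ht) (div_nonneg hC hc.le)
    have h2 : C / c * -(c * f t) = -(C * f t) := by field_simp
    linarith [hf' t ht]
  obtain ⟨v, hv⟩ := hVa.exists_tendsto_of_bddBelow hV0
  obtain ⟨g, hg⟩ := hGa.exists_tendsto_of_bddBelow (m := 0) fun t ht =>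
    add_nonneg (hf0 t ht) (mul_nonneg (div_nonneg hC hc.le) (hV0 t ht))
  have hfl : Tendsto f atTop (𝓝 (g - C / c * v)) := by
    simpa using hg.sub (hv.const_mul (C / c))
  set l := g - C / c * v
  have hl0 : 0 ≤ l := ge_of_tendsto hfl ((eventually_ge_atTop 0).mono hf0)
  rcases hl0.eq_or_lt with h | hl
  · rwa [← h] at hfl
  exfalso
  obtain ⟨T, hT⟩ := eventually_atTop.1
    ((hfl.eventually (lt_mem_nhds (half_lt_self hl))).and (eventually_ge_atTop (0 : ℝ)))
  have hT0 : 0 ≤ T := (hT T le_rfl).2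
  have hm : AntitoneOn (fun t => V t + c * (l / 2) * t) (Ici T) := by
    refine antitoneOn_of_hasDerivAt_nonpos (convex_Ici T)
      (fun t ht => (hV t (hT0.trans ht)).add ((hasDerivAt_id t).const_mul (c * (l / 2))))
      fun t ht => ?_
    have h1 := mul_le_mul_of_nonneg_left (hT t ht).1.le hc.le
    linarith [hV' t (hT0.trans ht)]
  have hcl : 0 < c * (l / 2) := by positivity
  have hVT := hV0 T hT0
  have hs : T ≤ T + (V T + 1) / (c * (l / 2)) := by
    have : 0 ≤ (V T + 1) / (c * (l / 2)) := by positivity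
    linarith
  have h1 := hm (mem_Ici.2 le_rfl) (mem_Ici.2 hs) hs
  have h2 := hV0 _ (hT0.trans hs)
  simp only [mul_add, mul_div_cancel₀ _ hcl.ne'] at h1
  linarith

theorem funnel_gain_inv_le {B x P : ℝ} (hB : 0 < B) (hd : Real.tanh x ^ 2 < B ^ 2)
    (hP : P = B * (1 - Real.tanh x ^ 2) * (B ^ 2 + Real.tanh x ^ 2) /
      (B ^ 2 - Real.tanh x ^ 2) ^ 2) : P⁻¹ ≤ B * (1 - Real.tanh x ^ 2)⁻¹ := by
  have h1 : 0 < 1 - Real.tanh x ^ 2 := sub_pos.2 (Real.tanh_sq_lt_one x)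
  have h2 : 0 < B ^ 2 - Real.tanh x ^ 2 := sub_pos.2 hd
  have h3 : 0 < B ^ 2 + Real.tanh x ^ 2 := by positivity
  have h4 : (B ^ 2 - Real.tanh x ^ 2) ^ 2 ≤ B ^ 2 * (B ^ 2 + Real.tanh x ^ 2) := by
    nlinarith [sq_nonneg (Real.tanh x)]
  have h5 : B * (1 - Real.tanh x ^ 2)⁻¹ =
      B ^ 2 * (B ^ 2 + Real.tanh x ^ 2) /
        (B * (1 - Real.tanh x ^ 2) * (B ^ 2 + Real.tanh x ^ 2)) := by
    field_simp
  rw [hP, inv_div, h5]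
  gcongr

theorem funnel_gain_le {B x P : ℝ} (hB : 0 < B) (hd : Real.tanh x ^ 2 < B ^ 2)
    (hP : P = B * (1 - Real.tanh x ^ 2) * (B ^ 2 + Real.tanh x ^ 2) /
      (B ^ 2 - Real.tanh x ^ 2) ^ 2) :
    P ≤ B * (B ^ 2 + 1) * ((B ^ 2 - Real.tanh x ^ 2)⁻¹) ^ 2 := by
  have h1 : Real.tanh x ^ 2 < 1 := Real.tanh_sq_lt_one x
  have h2 : 0 < B ^ 2 - Real.tanh x ^ 2 := sub_pos.2 hd
  have h4 : (1 - Real.tanh x ^ 2) * (B ^ 2 + Real.tanh x ^ 2) ≤ B ^ 2 + 1 := by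
    nlinarith [sq_nonneg (Real.tanh x), mul_nonneg (sq_nonneg (Real.tanh x)) (sq_nonneg B)]
  rw [hP, mul_assoc, div_eq_mul_inv, inv_pow]
  gcongr

/-- A bound on the transformed coordinate keeps the state away from the funnel boundary. -/
theorem funnel_distance_inv_le {B x z Bmin Bmax M : ℝ} (hmin : 0 < Bmin) (hB : Bmin ≤ B)
    (hBmax : B ≤ Bmax) (hd : Real.tanh x ^ 2 < B ^ 2)
    (hz : z = B * Real.tanh x / (B ^ 2 - Real.tanh x ^ 2)) (hM : z ^ 2 ≤ M) :
    (B ^ 2 - Real.tanh x ^ 2)⁻¹ ≤ Bmax ^ 2 * (M + 1) / Bmin ^ 4 := by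
  have h2 : 0 < B ^ 2 - Real.tanh x ^ 2 := sub_pos.2 hd
  have hB0 : 0 < B := hmin.trans_le hB
  have h3 : B ^ 2 * Real.tanh x ^ 2 = z ^ 2 * (B ^ 2 - Real.tanh x ^ 2) ^ 2 := by
    rw [hz]
    field_simp
  set d := B ^ 2 - Real.tanh x ^ 2 with hdef
  have hM0 : 0 ≤ M := (sq_nonneg z).trans hM
  have h4 : Bmin ^ 4 ≤ B ^ 4 := by gcongr
  have h5 : d ≤ Bmax ^ 2 := by
    have : B ^ 2 ≤ Bmax ^ 2 := by gcongr
    nlinarith [sq_nonneg (Real.tanh x)]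
  have h6 : B ^ 2 ≤ Bmax ^ 2 := by gcongr
  have h7 : B ^ 4 = B ^ 2 * d + z ^ 2 * d ^ 2 := by rw [← h3, hdef]; ring
  have h8 : z ^ 2 * d ≤ M * Bmax ^ 2 := by gcongr
  have h9 : B ^ 4 ≤ (Bmax ^ 2 * (M + 1)) * d := by
    have : B ^ 4 = (B ^ 2 + z ^ 2 * d) * d := by rw [h7]; ring
    rw [this]
    refine mul_le_mul_of_nonneg_right ?_ h2.le
    linarith
  rw [inv_le_iff_one_le_mul₀ h2, div_mul_eq_mul_div, one_le_div (by positivity)]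
  exact h4.trans h9

/-- The Lyapunov rate along the closed loop: since `z * P * x ≥ 0`, any constant upper bound `L`
of the parameter serves as its congealed value. -/
theorem lyapunov_rate_le {P W z x F q a r b l L k δ κ : ℝ} (hP : 0 < P) (hW : 0 < W)
    (hx : W * z = x) (hκ : κ = k / P + (δ + 1) / 2 + W ^ 2 / 2 * (a + F) ^ 2) (hk : 0 < k)
    (hδ : 0 ≤ δ) (hq : q ≤ L) (hb : l ≤ b) (hr : 0 ≤ r) :
    z * (P * (b * (r * (-κ * z)) + q * x) + P * F * x) + (a - L) * (z * P * x)
      - (l * r - 1) * (z * P * (-κ * z)) ≤ -(k * z ^ 2) := by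
  have hPk : P * κ = k + P * ((δ + 1) / 2 + W ^ 2 / 2 * (a + F) ^ 2) := by
    rw [hκ]
    field_simp
    ring
  have hκ0 : 0 ≤ κ := by rw [hκ]; positivity
  have hkey : P * z ^ 2 * (-((b - l) * r * κ) + (q - L) * W - δ / 2
      - (1 - W * (a + F)) ^ 2 / 2) ≤ 0 := by
    refine mul_nonpos_of_nonneg_of_nonpos (by positivity) ?_
    have h1 : 0 ≤ (b - l) * r * κ := mul_nonneg (mul_nonneg (sub_nonneg.2 hb) hr) hκ0
    have h2 : (q - L) * W ≤ 0 := mul_nonpos_of_nonpos_of_nonneg (sub_nonpos.2 hq) hW.le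
    nlinarith [sq_nonneg (1 - W * (a + F))]
  subst hx
  linear_combination hkey - z ^ 2 * hPk

set_option maxHeartbeats 2000000 in
/-- Theorem 1 of the paper (first-order motivating example, positive control
gain sign), with normalized function ψ = tanh. -/
theorem stmt_1
    (β : ℝ → ℝ) (hβdiff : Differentiable ℝ β) (hβ0 : β 0 = 1)
    (βmin : ℝ) (hβmin : 0 < βmin) (hβlb : ∀ t ≥ (0 : ℝ), βmin ≤ β t)
    (hβbd : ∃ C : ℝ, ∀ t ≥ (0 : ℝ), |β t| ≤ C)
    (hβ'bd : ∃ C : ℝ, ∀ t ≥ (0 : ℝ), |deriv β t| ≤ C)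
    (θ b : ℝ → ℝ) (ℓθ δ ℓb : ℝ) (hδ : 0 ≤ δ)
    (hθ : ∀ t ≥ (0 : ℝ), |θ t - ℓθ| ≤ δ)
    (hℓb : 0 < ℓb) (hb : ∀ t ≥ (0 : ℝ), ℓb ≤ b t)
    (k γθ γρ : ℝ) (hk : 0 < k) (hγθ : 0 < γθ) (hγρ : 0 < γρ)
    (x θhat ρhat : ℝ → ℝ)
    (hx : Differentiable ℝ x) (hθhat : Differentiable ℝ θhat)
    (hρhat : Differentiable ℝ ρhat)
    (z Pi W Φ κ ubar u : ℝ → ℝ)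
    (hz : ∀ t, z t =
      β t * Real.tanh (x t) / ((β t) ^ 2 - Real.tanh (x t) ^ 2))
    (hPi : ∀ t, Pi t =
      β t * (1 - Real.tanh (x t) ^ 2) * ((β t) ^ 2 + Real.tanh (x t) ^ 2) /
        ((β t) ^ 2 - Real.tanh (x t) ^ 2) ^ 2)
    (hW : ∀ t, W t = if x t = 0 then β t
      else x t * ((β t) ^ 2 - Real.tanh (x t) ^ 2) / (β t * Real.tanh (x t)))
    (hΦ : ∀ t, Φ t = if x t = 0 then -(deriv β t) / β t
      else -(deriv β t) * Real.tanh (x t) /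
        (β t * (1 - Real.tanh (x t) ^ 2) * x t))
    (hκ : ∀ t, κ t = k / Pi t + (δ + 1) / 2 + (W t) ^ 2 / 2 * (θhat t + Φ t) ^ 2)
    (hubar : ∀ t, ubar t = -(κ t) * z t)
    (hu : ∀ t, u t = ρhat t * ubar t)
    (hxode : ∀ t ≥ (0 : ℝ), deriv x t = b t * u t + θ t * x t)
    (hθode : ∀ t ≥ (0 : ℝ), deriv θhat t = γθ * z t * Pi t * x t)
    (hρode : ∀ t ≥ (0 : ℝ), deriv ρhat t = -γρ * z t * Pi t * ubar t)
    (hρ0 : 0 < ρhat 0) :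
    (∀ t ≥ (0 : ℝ), Real.tanh (x t) ^ 2 < (β t) ^ 2) ∧
    Filter.Tendsto x Filter.atTop (nhds 0) ∧
    (∃ θlim : ℝ, Filter.Tendsto θhat Filter.atTop (nhds θlim)) ∧
    (∃ ρlim : ℝ, Filter.Tendsto ρhat Filter.atTop (nhds ρlim)) ∧
    (∃ C : ℝ, ∀ t ≥ (0 : ℝ), |x t| ≤ C) ∧
    (∃ C : ℝ, ∀ t ≥ (0 : ℝ), |u t| ≤ C) ∧
    (∃ C : ℝ, ∀ t ≥ (0 : ℝ), |deriv θhat t| ≤ C) ∧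
    (∃ C : ℝ, ∀ t ≥ (0 : ℝ), |deriv ρhat t| ≤ C) := by
  have hβpos : ∀ t ≥ (0 : ℝ), 0 < β t := fun t ht => hβmin.trans_le (hβlb t ht)
  have hβsq : ∀ t ≥ (0 : ℝ), 0 < β t ^ 2 := fun t ht => pow_pos (hβpos t ht) 2
  set L := ℓθ + δ with hL
  have hθL : ∀ t ≥ (0 : ℝ), θ t ≤ L := fun t ht => by linarith [(abs_le.1 (hθ t ht)).2]
  set V : ℝ → ℝ := fun t => z t ^ 2 / 2 + (θhat t - L) ^ 2 / (2 * γθ)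
    + ℓb / (2 * γρ) * (ρhat t - 1 / ℓb) ^ 2 with hVdef
  set Ψ : ℝ → ℝ := fun t => Real.tanh (x t) * deriv β t * (β t ^ 2 + Real.tanh (x t) ^ 2) /
    (β t ^ 2 - Real.tanh (x t) ^ 2) ^ 2 with hΨ
  have hz' : ∀ t ≥ (0 : ℝ), Real.tanh (x t) ^ 2 < β t ^ 2 →
      HasDerivAt z (Pi t * (b t * u t + θ t * x t) - Ψ t) t := by
    intro t ht hd
    have h := hasDerivAt_funnel_transform (hβdiff t).hasDerivAt (hx t).hasDerivAt
      (sub_pos.2 hd).ne'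
    rw [← hPi t, hxode t ht] at h
    exact (funext hz : z = _) ▸ h
  have hκ0 : ∀ t ≥ (0 : ℝ), Real.tanh (x t) ^ 2 < β t ^ 2 → 0 ≤ κ t := by
    intro t ht hd
    have := funnel_gain_pos (hβpos t ht) hd (hPi t)
    rw [hκ]
    positivity
  have hV' : ∀ t ≥ (0 : ℝ), Real.tanh (x t) ^ 2 < β t ^ 2 →
      HasDerivAt V (z t * (Pi t * (b t * (ρhat t * (-κ t * z t)) + θ t * x t) + Pi t * Φ t * x t)
        + (θhat t - L) * (z t * Pi t * x t)
        - (ℓb * ρhat t - 1) * (z t * Pi t * (-κ t * z t))) t := by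
    intro t ht hd
    have h1 := (hθhat t).hasDerivAt
    have h2 := (hρhat t).hasDerivAt
    rw [hθode t ht] at h1
    rw [hρode t ht] at h2
    have h := ((((hz' t ht hd).pow 2).div_const 2).add
      (((h1.sub_const L).pow 2).div_const (2 * γθ))).add
      (((h2.sub_const (1 / ℓb)).pow 2).const_mul (ℓb / (2 * γρ)))
    refine h.congr_deriv ?_
    rw [funnel_drift_eq (hβpos t ht) hd (hPi t) (hΦ t), hu, hubar, hΨ]
    simp only [Nat.cast_ofNat, Nat.add_one_sub_one, pow_one]
    field_simp
    ring
  have hρmono : ∀ S : Set ℝ, Convex ℝ S → (∀ t ∈ S, 0 ≤ t ∧ Real.tanh (x t) ^ 2 < β t ^ 2) →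
      MonotoneOn ρhat S := by
    intro S hS hd
    refine monotoneOn_of_deriv_nonneg hS hρhat.continuous.continuousOn
      hρhat.differentiableOn fun t ht => ?_
    obtain ⟨ht0, hdt⟩ := hd t (interior_subset ht)
    have h1 := funnel_gain_pos (hβpos t ht0) hdt (hPi t)
    have h2 := hκ0 t ht0 hdt
    rw [hρode t ht0, hubar]
    have : -γρ * z t * Pi t * (-κ t * z t) = γρ * Pi t * κ t * z t ^ 2 := by ring
    rw [this]
    positivity
  have hrate : ∀ t ≥ (0 : ℝ), Real.tanh (x t) ^ 2 < β t ^ 2 → 0 ≤ ρhat t →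
      z t * (Pi t * (b t * (ρhat t * (-κ t * z t)) + θ t * x t) + Pi t * Φ t * x t)
        + (θhat t - L) * (z t * Pi t * x t)
        - (ℓb * ρhat t - 1) * (z t * Pi t * (-κ t * z t)) ≤ -(k * z t ^ 2) := fun t ht hd hr =>
    lyapunov_rate_le (funnel_gain_pos (hβpos t ht) hd (hPi t))
      (funnel_ratio_pos (hβpos t ht) hd (hW t)) (funnel_ratio_mul (hβpos t ht) hd (hz t) (hW t))
      (hκ t) hk hδ (hθL t ht) (hb t ht) hr
  have hVanti : ∀ S : Set ℝ, Convex ℝ S → (0 : ℝ) ∈ S →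
      (∀ t ∈ S, 0 ≤ t ∧ Real.tanh (x t) ^ 2 < β t ^ 2) → AntitoneOn V S := by
    intro S hS h0 hd
    refine antitoneOn_of_hasDerivAt_nonpos hS (fun t ht => hV' t (hd t ht).1 (hd t ht).2)
      fun t ht => ?_
    have hr := hρmono S hS hd h0 ht (hd t ht).1
    refine (hrate t (hd t ht).1 (hd t ht).2 (hρ0.le.trans hr)).trans ?_
    have := mul_nonneg hk.le (sq_nonneg (z t))
    linarith
  have hzV : ∀ t, z t ^ 2 ≤ 2 * V t := by
    intro t
    have h1 : 0 ≤ (θhat t - L) ^ 2 / (2 * γθ) := by positivity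
    have h2 : 0 ≤ ℓb / (2 * γρ) * (ρhat t - 1 / ℓb) ^ 2 := by positivity
    simp only [hVdef]
    linarith
  have hV0 : ∀ t, 0 ≤ V t := fun t => by linarith [hzV t, sq_nonneg (z t)]
  set M := 2 * V 0 with hM
  have hM0 : 0 ≤ M := by linarith [hV0 0]
  have hdist : Continuous fun t => β t ^ 2 - Real.tanh (x t) ^ 2 :=
    (hβdiff.continuous.pow 2).sub
      (((continuous_iff_continuousAt.2 fun y => (Real.hasDerivAt_tanh' y).continuousAt).comp
        hx.continuous).pow 2)
  have hfunnel : ∀ t ≥ (0 : ℝ), Real.tanh (x t) ^ 2 < β t ^ 2 := by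
    by_contra! hcon
    obtain ⟨t₁, ht₁, hd₁⟩ := hcon
    set E : Set ℝ := Ici 0 ∩ {t | β t ^ 2 - Real.tanh (x t) ^ 2 ≤ 0} with hE
    have hEcl : IsClosed E := isClosed_Ici.inter (isClosed_le hdist continuous_const)
    have hEne : E.Nonempty := ⟨t₁, ht₁, sub_nonpos.2 hd₁⟩
    have hEbd : BddBelow E := ⟨0, fun t ht => ht.1⟩
    have hTE : sInf E ∈ E := hEcl.csInf_mem hEne hEbd
    set T := sInf E
    have hbefore : ∀ t ∈ Ico 0 T, 0 ≤ t ∧ Real.tanh (x t) ^ 2 < β t ^ 2 := by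
      refine fun t ht => ⟨ht.1, ?_⟩
      by_contra! hcon
      exact absurd (csInf_le hEbd (show t ∈ E from ⟨ht.1, sub_nonpos.2 hcon⟩)) (not_le.2 ht.2)
    have hTpos : 0 < T := by
      rcases (mem_Ici.1 hTE.1).eq_or_lt with h | h
      · have h1 : β T ^ 2 - Real.tanh (x T) ^ 2 ≤ 0 := hTE.2
        rw [← h, hβ0] at h1
        linarith [Real.tanh_sq_lt_one (x 0)]
      · exact h
    have h0T : (0 : ℝ) ∈ Ico 0 T := ⟨le_rfl, hTpos⟩
    have hbound : ∀ t ∈ Ico 0 T, (β t * Real.tanh (x t)) ^ 2 ≤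
        M * (β t ^ 2 - Real.tanh (x t) ^ 2) ^ 2 := by
      intro t ht
      have hd := sub_pos.2 (hbefore t ht).2
      have h1 : z t ^ 2 ≤ M := (hzV t).trans
        (by linarith [hVanti _ (convex_Ico 0 T) h0T hbefore h0T ht ht.1])
      rwa [hz t, div_pow, div_le_iff₀ (by positivity)] at h1
    have hcl : T ∈ closure (Ico 0 T) := by
      rw [closure_Ico hTpos.ne]
      exact right_mem_Icc.2 hTpos.le
    have htanh : Continuous fun t => Real.tanh (x t) :=
      (continuous_iff_continuousAt.2 fun y => (Real.hasDerivAt_tanh' y).continuousAt).comp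
        hx.continuous
    have hTb := le_on_closure hbound ((hβdiff.continuous.mul htanh).pow 2).continuousOn
      (continuous_const.mul (hdist.pow 2)).continuousOn hcl
    have hT0 : 0 ≤ β T ^ 2 - Real.tanh (x T) ^ 2 :=
      le_on_closure (f := fun _ => (0 : ℝ)) (fun t ht => (sub_pos.2 (hbefore t ht).2).le)
        continuousOn_const hdist.continuousOn hcl
    have hTz : β T ^ 2 - Real.tanh (x T) ^ 2 = 0 := le_antisymm hTE.2 hT0
    rw [hTz, mul_pow, show Real.tanh (x T) ^ 2 = β T ^ 2 by linarith] at hTb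
    have := mul_pos (hβsq T hTpos.le) (hβsq T hTpos.le)
    norm_num at hTb
    linarith
  have hmem : ∀ t ∈ Ici (0 : ℝ), 0 ≤ t ∧ Real.tanh (x t) ^ 2 < β t ^ 2 := fun t ht =>
    ⟨ht, hfunnel t ht⟩
  have h0 : (0 : ℝ) ∈ Ici (0 : ℝ) := mem_Ici.2 le_rfl
  have hρm := hρmono _ (convex_Ici 0) hmem
  have hVa := hVanti _ (convex_Ici 0) h0 hmem
  have hρpos : ∀ t ≥ (0 : ℝ), 0 < ρhat t := fun t ht => hρ0.trans_le (hρm h0 ht ht)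
  have hVle : ∀ t ≥ (0 : ℝ), V t ≤ V 0 := fun t ht => hVa h0 ht ht
  have hzM : ∀ t ≥ (0 : ℝ), z t ^ 2 ≤ M := fun t ht => (hzV t).trans (by linarith [hVle t ht])
  obtain ⟨Cβ, hCβ⟩ := hβbd
  obtain ⟨Cβ', hCβ'⟩ := hβ'bd
  have hβle : ∀ t ≥ (0 : ℝ), β t ≤ Cβ := fun t ht => (le_abs_self _).trans (hCβ t ht)
  have hCβpos : 0 < Cβ := (hβpos 0 le_rfl).trans_le (hβle 0 le_rfl)
  have hCβ'0 : 0 ≤ Cβ' := (abs_nonneg _).trans (hCβ' 0 le_rfl)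
  set D := Cβ ^ 2 * (M + 1) / βmin ^ 4 with hD
  have hD0 : 0 ≤ D := by positivity
  have hdD : ∀ t ≥ (0 : ℝ), (β t ^ 2 - Real.tanh (x t) ^ 2)⁻¹ ≤ D := fun t ht =>
    funnel_distance_inv_le hβmin (hβlb t ht) (hβle t ht) (hfunnel t ht) (hz t) (hzM t ht)
  set Q := (Cβ ^ 2 + 1) * D with hQ
  have hqQ : ∀ t ≥ (0 : ℝ), (β t ^ 2 + Real.tanh (x t) ^ 2) *
      (β t ^ 2 - Real.tanh (x t) ^ 2)⁻¹ ≤ Q := by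
    intro t ht
    have h1 := (sub_pos.2 (hfunnel t ht)).le
    have h2 := (hβpos t ht).le
    have h3 := hβle t ht
    have h4 := (Real.tanh_sq_lt_one (x t)).le
    have h5 := hdD t ht
    rw [hQ]
    gcongr
  have hPW : ∀ t ≥ (0 : ℝ), Pi t * W t ≤ Q := fun t ht =>
    (funnel_gain_mul_ratio_le (hβpos t ht) (hfunnel t ht) (hPi t) (hW t)).trans (hqQ t ht)
  have hQ0 : 0 ≤ Q := by positivity
  have hPpos : ∀ t ≥ (0 : ℝ), 0 < Pi t := fun t ht =>
    funnel_gain_pos (hβpos t ht) (hfunnel t ht) (hPi t)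
  have hWpos : ∀ t ≥ (0 : ℝ), 0 < W t := fun t ht =>
    funnel_ratio_pos (hβpos t ht) (hfunnel t ht) (hW t)
  have hWz : ∀ t ≥ (0 : ℝ), W t * z t = x t := fun t ht =>
    funnel_ratio_mul (hβpos t ht) (hfunnel t ht) (hz t) (hW t)
  have hsq : Tendsto (fun t => z t ^ 2) atTop (𝓝 0) := by
    refine tendsto_zero_of_lyapunov (V := V) (C := 2 * (|L| * Q + Cβ' * βmin⁻¹ * Q)) hk
      (fun t ht => (hz' t ht (hfunnel t ht)).pow 2) (fun t ht => hV' t ht (hfunnel t ht))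
      (fun t _ => sq_nonneg _) (fun t _ => hV0 t) (by positivity) (fun t ht => ?_)
      (fun t ht => hrate t ht (hfunnel t ht) (hρpos t ht).le)
    have hβp := hβpos t ht
    have hdp := sub_pos.2 (hfunnel t ht)
    have hΨz : z t * Ψ t = (deriv β t) * (β t)⁻¹ * ((β t ^ 2 + Real.tanh (x t) ^ 2) *
      (β t ^ 2 - Real.tanh (x t) ^ 2)⁻¹) * z t ^ 2 := by
      simp only [hΨ, hz t]
      field_simp
    have h1 : -(z t * Ψ t) ≤ Cβ' * βmin⁻¹ * Q * z t ^ 2 := by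
      refine (neg_le_abs _).trans ?_
      rw [hΨz, abs_mul, abs_mul, abs_mul, abs_of_pos (inv_pos.2 hβp),
        abs_of_nonneg (sq_nonneg (z t)), abs_of_nonneg (a := (_ + _) * _) (by positivity)]
      have h2 := hCβ' t ht
      have h3 := hβlb t ht
      have h4 := hqQ t ht
      gcongr
    have h5 : θ t * (Pi t * W t) * z t ^ 2 ≤ |L| * Q * z t ^ 2 := by
      have h6 := hPW t ht
      have h7 := (hθL t ht).trans (le_abs_self L)
      have h8 := mul_pos (hPpos t ht) (hWpos t ht)
      refine mul_le_mul_of_nonneg_right ?_ (sq_nonneg _)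
      exact mul_le_mul h7 h6 h8.le (abs_nonneg L)
    have h9 : 0 ≤ Pi t * b t * ρhat t * κ t * z t ^ 2 := by
      have h1 := hPpos t ht
      have h2 := hℓb.trans_le (hb t ht)
      have h3 := hρpos t ht
      have h4 := hκ0 t ht (hfunnel t ht)
      positivity
    simp only [Nat.cast_ofNat, Nat.add_one_sub_one, pow_one]
    rw [hu, hubar, ← hWz t ht]
    linarith
  have hψ0 : Tendsto (fun t => |Real.tanh (x t)|) atTop (𝓝 0) := by
    have hz0 : Tendsto (fun t => Cβ * |z t|) atTop (𝓝 0) := by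
      have := (Real.continuous_sqrt.tendsto 0).comp hsq
      simpa [Function.comp_def, Real.sqrt_sq_eq_abs] using this.const_mul Cβ
    refine squeeze_zero' (Eventually.of_forall fun t => abs_nonneg _) ?_ hz0
    filter_upwards [eventually_ge_atTop 0] with t ht
    have hβp := hβpos t ht
    have hdp := sub_pos.2 (hfunnel t ht)
    have h1 := hβle t ht
    have h2 : (β t ^ 2 - Real.tanh (x t) ^ 2) ≤ β t ^ 2 := by
      linarith [sq_nonneg (Real.tanh (x t))]
    rw [hz t, abs_div, abs_mul, abs_of_pos hβp, abs_of_pos hdp, mul_div_assoc', le_div_iff₀ hdp]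
    calc |Real.tanh (x t)| * (β t ^ 2 - Real.tanh (x t) ^ 2)
        ≤ |Real.tanh (x t)| * β t ^ 2 := by gcongr
      _ = β t * (β t * |Real.tanh (x t)|) := by ring
      _ ≤ Cβ * (β t * |Real.tanh (x t)|) := by gcongr
  have hx0 : Tendsto x atTop (𝓝 0) := by
    have h1 : Tendsto (fun t => |Real.tanh (x t)| / (1 - |Real.tanh (x t)| ^ 2)) atTop (𝓝 0) := by
      have : Tendsto (fun t => |Real.tanh (x t)| / (1 - |Real.tanh (x t)| ^ 2)) atTop
          (𝓝 (0 / (1 - 0 ^ 2))) :=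
        hψ0.div (tendsto_const_nhds.sub (hψ0.pow 2)) (by norm_num)
      simpa using this
    refine squeeze_zero_norm (fun t => ?_) h1
    rw [sq_abs, le_div_iff₀ (sub_pos.2 (Real.tanh_sq_lt_one _))]
    exact Real.abs_mul_one_sub_tanh_sq_le (x t)
  obtain ⟨X, hX⟩ : ∃ C : ℝ, ∀ t ≥ (0 : ℝ), |x t| ≤ C := by
    obtain ⟨T, hT⟩ := eventually_atTop.1
      ((tendsto_order.1 hx0.abs).2 1 (by norm_num))
    obtain ⟨C, hC⟩ := isCompact_Icc.exists_bound_of_continuousOn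
      (hx.continuous.continuousOn (s := Icc 0 T))
    refine ⟨max C 1, fun t ht => ?_⟩
    rcases le_total t T with h | h
    · exact (hC t ⟨ht, h⟩).trans (le_max_left _ _)
    · exact (hT t h).le.trans (le_max_right _ _)
  have hθbd : ∀ t ≥ (0 : ℝ), |θhat t| ≤ |L| + √(2 * γθ * V 0) := by
    intro t ht
    have h1 : (θhat t - L) ^ 2 ≤ 2 * γθ * V 0 := by
      have h2 : 0 ≤ ℓb / (2 * γρ) * (ρhat t - 1 / ℓb) ^ 2 := by positivity
      have h3 : (θhat t - L) ^ 2 / (2 * γθ) ≤ V 0 := by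
        have := hVle t ht
        simp only [hVdef] at this ⊢
        linarith [sq_nonneg (z t)]
      rw [div_le_iff₀ (by positivity)] at h3
      linarith
    have h4 := Real.abs_le_sqrt h1
    have h5 := abs_sub_abs_le_abs_sub (θhat t) L
    linarith
  set A := |L| + √(2 * γθ * V 0)
  have hρbd : ∀ t ≥ (0 : ℝ), ρhat t ≤ 1 / ℓb + √(2 * γρ / ℓb * V 0) := by
    intro t ht
    have h1 : (ρhat t - 1 / ℓb) ^ 2 ≤ 2 * γρ / ℓb * V 0 := by
      have h2 : 0 ≤ (θhat t - L) ^ 2 / (2 * γθ) := by positivity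
      have h3 : ℓb / (2 * γρ) * (ρhat t - 1 / ℓb) ^ 2 ≤ V 0 := by
        have := hVle t ht
        simp only [hVdef] at this ⊢
        linarith [sq_nonneg (z t)]
      calc (ρhat t - 1 / ℓb) ^ 2
          = 2 * γρ / ℓb * (ℓb / (2 * γρ) * (ρhat t - 1 / ℓb) ^ 2) := by field_simp
        _ ≤ _ := by gcongr
    have h4 := (le_abs_self _).trans (Real.abs_le_sqrt h1)
    linarith
  set R := 1 / ℓb + √(2 * γρ / ℓb * V 0)
  have hR0 : 0 ≤ R := by positivity
  have hzx : ∀ t ≥ (0 : ℝ), z t * Pi t * x t = Pi t * W t * z t ^ 2 := fun t ht => by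
    rw [← hWz t ht]; ring
  have hθm : MonotoneOn θhat (Ici 0) := by
    refine monotoneOn_of_deriv_nonneg (convex_Ici 0) hθhat.continuous.continuousOn
      hθhat.differentiableOn fun t ht => ?_
    have ht0 : 0 ≤ t := interior_subset ht
    have h1 := hPpos t ht0
    have h2 := hWpos t ht0
    rw [hθode t ht0, mul_assoc, mul_assoc, ← mul_assoc (z t), hzx t ht0]
    positivity
  have hcosh : ∀ t ≥ (0 : ℝ), (1 - Real.tanh (x t) ^ 2)⁻¹ ≤ Real.cosh X ^ 2 := by
    intro t ht
    rw [Real.one_sub_tanh_sq, inv_inv]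
    have h1 := Real.cosh_le_cosh.2 ((hX t ht).trans (le_abs_self X))
    have h2 := (Real.cosh_pos (x t)).le
    gcongr
  set K := Real.cosh X ^ 2
  have hK0 : 0 ≤ K := sq_nonneg _
  have hψ1 : ∀ t, 0 < 1 - Real.tanh (x t) ^ 2 := fun t => sub_pos.2 (Real.tanh_sq_lt_one _)
  have hWle : ∀ t ≥ (0 : ℝ), W t ≤ Cβ ^ 2 * βmin⁻¹ * K := by
    intro t ht
    refine (funnel_ratio_le (hβpos t ht) (hfunnel t ht) (hW t)).trans ?_
    have h1 := hcosh t ht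
    have h2 := hβlb t ht
    have h3 : β t ^ 2 - Real.tanh (x t) ^ 2 ≤ Cβ ^ 2 := by
      have := pow_le_pow_left₀ (hβpos t ht).le (hβle t ht) 2
      linarith [sq_nonneg (Real.tanh (x t))]
    have h4 := hψ1 t
    have h5 := hβpos t ht
    gcongr
  have hΦle : ∀ t ≥ (0 : ℝ), |Φ t| ≤ Cβ' * βmin⁻¹ * K := by
    intro t ht
    refine (funnel_feedforward_abs_le (hβpos t ht) (hΦ t)).trans ?_
    have h1 := hcosh t ht
    have h2 := hβlb t ht
    have h3 := hCβ' t ht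
    have h4 := hψ1 t
    have h5 := hβpos t ht
    gcongr
  have hκle : ∀ t ≥ (0 : ℝ), κ t ≤ k * (Cβ * K) + (δ + 1) / 2
      + (Cβ ^ 2 * βmin⁻¹ * K) ^ 2 / 2 * (A + Cβ' * βmin⁻¹ * K) ^ 2 := by
    intro t ht
    have h1 : (Pi t)⁻¹ ≤ Cβ * K := by
      refine (funnel_gain_inv_le (hβpos t ht) (hfunnel t ht) (hPi t)).trans ?_
      have h1 := hcosh t ht
      have h2 := hβle t ht
      have h4 := hψ1 t
      gcongr
    have h2 : (θhat t + Φ t) ^ 2 ≤ (A + Cβ' * βmin⁻¹ * K) ^ 2 := by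
      refine sq_le_sq' ?_ ?_ <;>
        linarith [(abs_le.1 (hθbd t ht)).1, (abs_le.1 (hθbd t ht)).2, (abs_le.1 (hΦle t ht)).1,
          (abs_le.1 (hΦle t ht)).2]
    have h3 := hWle t ht
    have h4 := (hWpos t ht).le
    rw [hκ, div_eq_mul_inv k]
    gcongr
  set Kκ := k * (Cβ * K) + (δ + 1) / 2
    + (Cβ ^ 2 * βmin⁻¹ * K) ^ 2 / 2 * (A + Cβ' * βmin⁻¹ * K) ^ 2
  have hzle : ∀ t ≥ (0 : ℝ), |z t| ≤ √M := fun t ht => Real.abs_le_sqrt (hzM t ht)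
  have hubar_le : ∀ t ≥ (0 : ℝ), |ubar t| ≤ Kκ * √M := by
    intro t ht
    have h1 := hκ0 t ht (hfunnel t ht)
    have h2 := hκle t ht
    have h3 := hzle t ht
    rw [hubar, abs_mul, abs_neg, abs_of_nonneg h1]
    gcongr
  have hPle : ∀ t ≥ (0 : ℝ), Pi t ≤ Cβ * (Cβ ^ 2 + 1) * D ^ 2 := by
    intro t ht
    refine (funnel_gain_le (hβpos t ht) (hfunnel t ht) (hPi t)).trans ?_
    have h1 := hdD t ht
    have h2 := hβle t ht
    have h3 := (hβpos t ht).le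
    have h4 := (sub_pos.2 (hfunnel t ht)).le
    gcongr
  refine ⟨hfunnel, hx0, hθm.exists_tendsto_of_bddAbove fun t ht =>
    (le_abs_self _).trans (hθbd t ht), hρm.exists_tendsto_of_bddAbove hρbd, ⟨X, hX⟩,
    ⟨R * (Kκ * √M), fun t ht => ?_⟩, ⟨γθ * (Q * M), fun t ht => ?_⟩,
    ⟨γρ * √M * (Cβ * (Cβ ^ 2 + 1) * D ^ 2) * (Kκ * √M), fun t ht => ?_⟩⟩
  · have h1 := hρbd t ht
    have h2 := hubar_le t ht
    rw [hu, abs_mul, abs_of_pos (hρpos t ht)]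
    gcongr
  · have h1 := hPW t ht
    have h2 := hzM t ht
    have h3 := hPpos t ht
    have h4 := hWpos t ht
    rw [hθode t ht, mul_assoc, mul_assoc, ← mul_assoc (z t), hzx t ht, abs_of_nonneg (by positivity)]
    gcongr
  · have h1 := hzle t ht
    have h2 := hPle t ht
    have h3 := hPpos t ht
    have h4 := hubar_le t ht
    rw [hρode t ht, abs_mul, abs_mul, abs_mul, abs_neg, abs_of_pos hγρ, abs_of_pos h3]
    gcongr
end

section
/- Let β > 0 and ψ ∈ ℝ with ψ² < β², and let M > 0. If |β·ψ/(β² − ψ²)| ≤ M, then |ψ| ≤ β·(√(1+4M²) − 1)/(2M). In particular |ψ| ≤ c·β with c = (√(1+4M²) − 1)/(2M) < 1, so that β² − ψ² ≥ (1 − c²)β². -/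
/-- Quantitative funnel margin: if z = βψ/(β²−ψ²) is bounded by M, then
ψ stays a uniform fraction c < 1 inside the boundary β. -/
theorem stmt_3 (β ψ M : ℝ) (hβ : 0 < β) (hψ : ψ ^ 2 < β ^ 2) (hM : 0 < M)
    (h : |β * ψ / (β ^ 2 - ψ ^ 2)| ≤ M) :
    |ψ| ≤ β * ((Real.sqrt (1 + 4 * M ^ 2) - 1) / (2 * M)) ∧
    (Real.sqrt (1 + 4 * M ^ 2) - 1) / (2 * M) < 1 ∧
    (1 - ((Real.sqrt (1 + 4 * M ^ 2) - 1) / (2 * M)) ^ 2) * β ^ 2 ≤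
      β ^ 2 - ψ ^ 2 := by
  have hs : Real.sqrt (1 + 4 * M ^ 2) ^ 2 = 1 + 4 * M ^ 2 := Real.sq_sqrt (by positivity)
  have hs1 : 1 < Real.sqrt (1 + 4 * M ^ 2) := by
    rw [Real.lt_sqrt (by norm_num)]
    nlinarith [pow_pos hM 2]
  generalize Real.sqrt (1 + 4 * M ^ 2) = s at hs hs1 ⊢
  have hc0 : 0 < (s - 1) / (2 * M) :=
    div_pos (by linarith) (by positivity)
  have hc : M * ((s - 1) / (2 * M)) ^ 2 +
      (s - 1) / (2 * M) = M := by
    field_simp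
    linear_combination hs
  generalize (s - 1) / (2 * M) = c at hc0 hc ⊢
  rw [abs_div, abs_mul, abs_of_pos hβ, abs_of_pos (sub_pos.2 hψ),
    div_le_iff₀ (sub_pos.2 hψ), ← sq_abs ψ] at h
  have hle : |ψ| ≤ β * c := by
    by_contra! hlt
    have hsq : (β * c) ^ 2 < |ψ| ^ 2 := pow_lt_pow_left₀ hlt (by positivity) two_ne_zero
    have h1 := mul_lt_mul_of_pos_left hlt hβ
    have h2 := mul_lt_mul_of_pos_left hsq hM
    linarith [show β ^ 2 * (M * c ^ 2 + c) = M * (β * c) ^ 2 + β * (β * c) by ring,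
      show β ^ 2 * (M * c ^ 2 + c) = β ^ 2 * M by rw [hc]]
  refine ⟨hle, ?_, ?_⟩
  · by_contra! h1
    nlinarith [mul_le_mul_of_nonneg_left (one_le_pow₀ h1 : 1 ≤ c ^ 2) hM.le]
  · have hsq : |ψ| ^ 2 ≤ (β * c) ^ 2 := pow_le_pow_left₀ (abs_nonneg ψ) hle 2
    rw [sq_abs] at hsq
    linarith [mul_pow β c 2]
end

section
/- Let ψ : ℝ → ℝ be continuous, strictly increasing, with ψ(0) = 0 and ψ(x)² < 1 for all x. Let β : [0,∞) → ℝ satisfy 0 < β_min ≤ β(t) ≤ B for all t and constants β_min, B. Let x : [0,∞) → ℝ be such that β(t)² ≠ ψ(x(t))² for all t, and define z(t) = β(t)ψ(x(t))/(β(t)² − ψ(x(t))²). If z(t) → 0 as t → ∞, then x(t) → 0 as t → ∞. -/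
theorem StrictMono.tendsto_of_tendsto_comp {ι α β : Type*} [LinearOrder α] [TopologicalSpace α]
    [OrderTopology α] [LinearOrder β] [TopologicalSpace β] [OrderTopology β] {f : α → β}
    (hf : StrictMono f) {l : Filter ι} {x : ι → α} {a : α}
    (h : Filter.Tendsto (fun i => f (x i)) l (nhds (f a))) :
    Filter.Tendsto x l (nhds a) :=
  tendsto_order.2
    ⟨fun _ hb => (h.eventually_const_lt (hf hb)).mono fun _ hi => hf.lt_iff_lt.1 hi,
      fun _ hb => (h.eventually_lt_const (hf hb)).mono fun _ hi => hf.lt_iff_lt.1 hi⟩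

theorem abs_le_of_mul_div_sq_sub_sq {b s m B : ℝ} (hm : 0 < m) (hmb : m ≤ b) (hbB : b ≤ B)
    (hs : s ^ 2 ≤ 1) (hne : b ^ 2 ≠ s ^ 2) :
    |s| ≤ |b * s / (b ^ 2 - s ^ 2)| * ((B ^ 2 + 1) / m) := by
  have hb : 0 < b := hm.trans_le hmb
  have hden : |b ^ 2 - s ^ 2| ≤ B ^ 2 + 1 :=
    abs_le.2 ⟨by nlinarith [sq_nonneg b, sq_nonneg B], by nlinarith [sq_nonneg s]⟩
  rw [← mul_div_assoc, le_div_iff₀ hm]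
  calc |s| * m ≤ |s| * b := by gcongr
    _ = |b * s / (b ^ 2 - s ^ 2)| * |b ^ 2 - s ^ 2| := by
      rw [← abs_mul, div_mul_cancel₀ _ (sub_ne_zero.2 hne), abs_mul, abs_of_pos hb, mul_comm]
    _ ≤ |b * s / (b ^ 2 - s ^ 2)| * (B ^ 2 + 1) := by gcongr

/-- If the transformed coordinate z(t) = β(t)ψ(x(t))/(β(t)² − ψ(x(t))²)
tends to zero, then so does the original state x(t). -/
theorem stmt_4 (ψ β x z : ℝ → ℝ)
    (hψc : Continuous ψ) (hψmono : StrictMono ψ) (hψ0 : ψ 0 = 0)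
    (hψlt : ∀ y : ℝ, (ψ y) ^ 2 < 1)
    (βmin B : ℝ) (hβmin : 0 < βmin)
    (hβ : ∀ t ≥ (0 : ℝ), βmin ≤ β t ∧ β t ≤ B)
    (hne : ∀ t ≥ (0 : ℝ), (β t) ^ 2 ≠ (ψ (x t)) ^ 2)
    (hz : ∀ t, z t = β t * ψ (x t) / ((β t) ^ 2 - (ψ (x t)) ^ 2))
    (hzto : Filter.Tendsto z Filter.atTop (nhds 0)) :
    Filter.Tendsto x Filter.atTop (nhds 0) := by
  refine hψmono.tendsto_of_tendsto_comp ?_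
  rw [hψ0]
  refine squeeze_zero_norm' (a := fun t => |z t| * ((B ^ 2 + 1) / βmin)) ?_
    (by simpa using hzto.abs.mul_const ((B ^ 2 + 1) / βmin))
  filter_upwards [Filter.eventually_ge_atTop 0] with t ht
  rw [Real.norm_eq_abs, hz t]
  exact abs_le_of_mul_div_sq_sub_sq hβmin (hβ t ht).1 (hβ t ht).2 (hψlt _).le (hne t ht)
end

section
/- Let 0 < β_min ≤ 1 and M > 0. Then there exist constants m > 0 and M′ > 0, depending only on β_min and M, with the following property: for every β with β_min ≤ β ≤ 1 and every x ∈ ℝ such that tanh(x)² < β² and |β·tanh(x)/(β² − tanh(x)²)| ≤ M, the quantity Π := β·(1 − tanh(x)²)·(β² + tanh(x)²)/(β² − tanh(x)²)² satisfies m ≤ Π ≤ M′. -/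
/-- If `β·u/(β² − u²)` is bounded by `M`, then `u²` stays quantitatively away from `β²`. -/
theorem pow_four_le_of_abs_div_le {β u M : ℝ} (hβ : β ^ 2 ≤ 1) (hu : u ^ 2 < β ^ 2)
    (hz : |β * u / (β ^ 2 - u ^ 2)| ≤ M) :
    β ^ 4 ≤ (1 + M ^ 2) * (β ^ 2 - u ^ 2) := by
  have hD : 0 < β ^ 2 - u ^ 2 := sub_pos.2 hu
  have hD1 : β ^ 2 - u ^ 2 ≤ 1 := by nlinarith [sq_nonneg u]
  rw [abs_div, abs_of_pos hD, div_le_iff₀ hD] at hz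
  have hsq : (β * u) ^ 2 ≤ M ^ 2 * (β ^ 2 - u ^ 2) ^ 2 := by
    rw [← mul_pow]
    exact sq_le_sq' (neg_le_of_abs_le hz) (le_of_abs_le hz)
  have hDD : (β ^ 2 - u ^ 2) ^ 2 ≤ β ^ 2 - u ^ 2 := by nlinarith
  calc β ^ 4 = β ^ 2 * (β ^ 2 - u ^ 2) + (β * u) ^ 2 := by ring
    _ ≤ 1 * (β ^ 2 - u ^ 2) + M ^ 2 * (β ^ 2 - u ^ 2) :=
        add_le_add (mul_le_mul_of_nonneg_right hβ hD.le)
          (hsq.trans (mul_le_mul_of_nonneg_left hDD (sq_nonneg M)))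
    _ = (1 + M ^ 2) * (β ^ 2 - u ^ 2) := by ring


/-- Uniform two-sided bounds on Π = β·(1−tanh²x)·(β²+tanh²x)/(β²−tanh²x)²
whenever the transformed coordinate z is bounded by M and β ∈ [βmin, 1]. -/
theorem stmt_16 (βmin M : ℝ) (hβmin : 0 < βmin) (hβmin1 : βmin ≤ 1)
    (hM : 0 < M) :
    ∃ m > (0 : ℝ), ∃ M' > (0 : ℝ), ∀ β x : ℝ,
      βmin ≤ β → β ≤ 1 →
      Real.tanh x ^ 2 < β ^ 2 →
      |β * Real.tanh x / (β ^ 2 - Real.tanh x ^ 2)| ≤ M →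
      m ≤ β * (1 - Real.tanh x ^ 2) * (β ^ 2 + Real.tanh x ^ 2) /
            (β ^ 2 - Real.tanh x ^ 2) ^ 2 ∧
      β * (1 - Real.tanh x ^ 2) * (β ^ 2 + Real.tanh x ^ 2) /
            (β ^ 2 - Real.tanh x ^ 2) ^ 2 ≤ M' := by
  have hd : 0 < βmin ^ 4 / (1 + M ^ 2) := by positivity
  refine ⟨βmin ^ 3, by positivity, 2 / (βmin ^ 4 / (1 + M ^ 2)) ^ 2, by positivity, ?_⟩
  intro β x hβ hβ1 hu hz
  generalize Real.tanh x = u at hu hz ⊢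
  have hβ0 : 0 < β := hβmin.trans_le hβ
  have hβsq : β ^ 2 ≤ 1 := pow_le_one₀ hβ0.le hβ1
  have hu0 : 0 ≤ u ^ 2 := sq_nonneg u
  have hD : 0 < β ^ 2 - u ^ 2 := sub_pos.2 hu
  have hdD : βmin ^ 4 / (1 + M ^ 2) ≤ β ^ 2 - u ^ 2 := by
    rw [div_le_iff₀' (by positivity)]
    exact (pow_le_pow_left₀ hβmin.le hβ 4).trans (pow_four_le_of_abs_div_le hβsq hu hz)
  constructor
  · rw [le_div_iff₀ (by positivity)]
    calc βmin ^ 3 * (β ^ 2 - u ^ 2) ^ 2 ≤ β ^ 3 * (1 - u ^ 2) := by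
          gcongr
          nlinarith
      _ = β * (1 - u ^ 2) * β ^ 2 := by ring
      _ ≤ β * (1 - u ^ 2) * (β ^ 2 + u ^ 2) :=
          mul_le_mul_of_nonneg_left (by linarith) (mul_nonneg hβ0.le (by linarith))
  · refine div_le_div₀ zero_le_two ?_ (by positivity) (by gcongr)
    calc β * (1 - u ^ 2) * (β ^ 2 + u ^ 2) ≤ 1 * 1 * 2 := by
          gcongr <;> linarith
      _ = 2 := by norm_num
end
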